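/- Let p : ℝ^d → ℝ be a smooth, everywhere-positive probability density, and let s : ℝ^d → ℝ^d be a C¹ vector field with compact support. Assume ∇p is integrable. Then the explicit and implicit score-matching objectives agree up to a constant independent of s: ∫_{ℝ^d} ‖s(x) − ∇log p(x)‖² p(x) dx = ∫_{ℝ^d} (2·div s(x) + ‖s(x)‖²) p(x) dx + ∫_{ℝ^d} ‖∇log p(x)‖² p(x) dx, where the last integral (assumed finite) does not depend on s. -/

import Mathlib

open MeasureTheory

/-- Divergence of a vector field on `ℝ^d`: the sum of the partial derivatives
of the coordinate functions. -/
noncomputable def divergence {d : ℕ}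
    (v : EuclideanSpace ℝ (Fin d) → EuclideanSpace ℝ (Fin d))
    (x : EuclideanSpace ℝ (Fin d)) : ℝ :=
  ∑ i : Fin d, fderiv ℝ v x (EuclideanSpace.single i 1) i

/-- Coordinates of the derivative of a vector field. -/
lemma fderiv_coord {d : ℕ} (s : EuclideanSpace ℝ (Fin d) → EuclideanSpace ℝ (Fin d))
    (hs : ContDiff ℝ 1 s) (i : Fin d) (x v : EuclideanSpace ℝ (Fin d)) :
    fderiv ℝ (fun y => s y i) x v = fderiv ℝ s x v i := by
  have h1 : HasFDerivAt s (fderiv ℝ s x) x := (hs.differentiable (by norm_num) x).hasFDerivAt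
  have h2 := (EuclideanSpace.proj i : EuclideanSpace ℝ (Fin d) →L[ℝ] ℝ).hasFDerivAt (x := s x)
  have h3 := h2.comp x h1
  have h4 : fderiv ℝ (fun y => s y i) x
      = (EuclideanSpace.proj i : EuclideanSpace ℝ (Fin d) →L[ℝ] ℝ).comp (fderiv ℝ s x) := h3.fderiv
  rw [h4]
  rfl

/-- Integration by parts: `∫ ⟨s, ∇p⟩ = - ∫ (div s) p`. -/
lemma integral_by_parts_div {d : ℕ} (p : EuclideanSpace ℝ (Fin d) → ℝ)
    (s : EuclideanSpace ℝ (Fin d) → EuclideanSpace ℝ (Fin d))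
    (hp : ContDiff ℝ 1 p) (hs : ContDiff ℝ 1 s) (hsupp : HasCompactSupport s) :
    Integrable (fun x => fderiv ℝ p x (s x)) ∧ Integrable (fun x => divergence s x * p x) ∧
    ∫ x, fderiv ℝ p x (s x) = - ∫ x, divergence s x * p x := by
  have hsi : ∀ i, ContDiff ℝ 1 (fun x => s x i) := fun i =>
    (EuclideanSpace.proj i : EuclideanSpace ℝ (Fin d) →L[ℝ] ℝ).contDiff.comp hs
  have hci : ∀ i, HasCompactSupport (fun x => s x i) := fun i =>
    hsupp.comp_left (g := fun v : EuclideanSpace ℝ (Fin d) => v i) rfl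
  have hdp : ∀ v, Continuous (fun x => fderiv ℝ p x v) := fun v =>
    (hp.continuous_fderiv (by norm_num)).clm_apply continuous_const
  have hdsi : ∀ i v, Continuous (fun x => fderiv ℝ (fun y => s y i) x v) := fun i v =>
    ((hsi i).continuous_fderiv (by norm_num)).clm_apply continuous_const
  have hcd : ∀ i v, HasCompactSupport (fun x => fderiv ℝ (fun y => s y i) x v) := fun i v =>
    (hci i).fderiv_apply (𝕜 := ℝ) v
  have i1 : ∀ i, Integrable (fun x => s x i * fderiv ℝ p x (EuclideanSpace.single i 1)) :=
    fun i => ((hsi i).continuous.mul (hdp _)).integrable_of_hasCompactSupport ((hci i).mul_right)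
  have i2 : ∀ i, Integrable
      (fun x => fderiv ℝ (fun y => s y i) x (EuclideanSpace.single i 1) * p x) :=
    fun i => ((hdsi i _).mul hp.continuous).integrable_of_hasCompactSupport ((hcd i _).mul_right)
  have i3 : ∀ i, Integrable (fun x => s x i * p x) :=
    fun i => ((hsi i).continuous.mul hp.continuous).integrable_of_hasCompactSupport
      ((hci i).mul_right)
  have e1 : (fun x => fderiv ℝ p x (s x))
      = fun x => ∑ i, s x i * fderiv ℝ p x (EuclideanSpace.single i 1) := by
    funext x
    have h := (EuclideanSpace.basisFun (Fin d) ℝ).sum_repr (s x)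
    conv_lhs => rw [← h]
    simp [map_sum]
  have e2 : (fun x => divergence s x * p x)
      = fun x => ∑ i, fderiv ℝ (fun y => s y i) x (EuclideanSpace.single i 1) * p x := by
    funext x
    simp only [divergence, Finset.sum_mul, fderiv_coord s hs]
  rw [e1, e2]
  refine ⟨integrable_finsetSum _ fun i _ => i1 i, integrable_finsetSum _ fun i _ => i2 i, ?_⟩
  rw [integral_finsetSum _ fun i _ => i1 i, integral_finsetSum _ fun i _ => i2 i,
    ← Finset.sum_neg_distrib]
  refine Finset.sum_congr rfl fun i _ => ?_
  exact integral_mul_fderiv_eq_neg_fderiv_mul_of_integrable (i2 i) (i1 i) (i3 i)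
    (fun x _ => (hsi i).differentiable (by norm_num) x)
    (fun x _ => hp.differentiable (by norm_num) x)

/-- Hyvärinen's identity: for a smooth positive probability density `p` with integrable
gradient and a compactly supported `C¹` vector field `s`, the explicit score-matching
objective equals the implicit one plus a constant independent of `s`. -/
theorem score_matching_eq_implicit_score_matching_add_const
    (d : ℕ)
    (p : EuclideanSpace ℝ (Fin d) → ℝ)
    (s : EuclideanSpace ℝ (Fin d) → EuclideanSpace ℝ (Fin d))
    (hp : ContDiff ℝ (⊤ : ℕ∞) p)
    (hpos : ∀ x, 0 < p x)
    (hprob : ∫ x, p x = 1)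
    (hs : ContDiff ℝ 1 s)
    (hsupp : HasCompactSupport s)
    (hgradp : Integrable (fun x => gradient p x))
    (hfin : Integrable (fun x => ‖gradient (fun y => Real.log (p y)) x‖ ^ 2 * p x)) :
    ∫ x, ‖s x - gradient (fun y => Real.log (p y)) x‖ ^ 2 * p x
      = (∫ x, (2 * divergence s x + ‖s x‖ ^ 2) * p x)
        + ∫ x, ‖gradient (fun y => Real.log (p y)) x‖ ^ 2 * p x := by
  have hp1 : ContDiff ℝ 1 p := hp.of_le (by exact_mod_cast (le_top : (1 : ℕ∞) ≤ ⊤))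
  obtain ⟨j1, j2, j3⟩ := integral_by_parts_div p s hp1 hs hsupp
  have j4 : Integrable (fun x => ‖s x‖ ^ 2 * p x) := by
    have hc : HasCompactSupport (fun x => ‖s x‖ ^ 2) :=
      hsupp.mono' (fun x hx => subset_tsupport s (fun h0 => hx (by simp [h0])))
    exact ((hs.continuous.norm.pow 2).mul hp.continuous).integrable_of_hasCompactSupport
      hc.mul_right
  have key : ∀ x, inner ℝ (s x) (gradient (fun y => Real.log (p y)) x) * p x
      = fderiv ℝ p x (s x) := by
    intro x
    have h0 : HasFDerivAt p (fderiv ℝ p x) x :=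
      (hp1.differentiable one_ne_zero x).hasFDerivAt
    have hd : HasFDerivAt (fun y => Real.log (p y)) ((p x)⁻¹ • fderiv ℝ p x) x := h0.log (hpos x).ne'
    rw [real_inner_comm, gradient, InnerProductSpace.toDual_symm_apply, hd.fderiv]
    have := (hpos x).ne'
    simp only [_root_.smul_apply, smul_eq_mul]
    field_simp
  have e : ∀ x, ‖s x - gradient (fun y => Real.log (p y)) x‖ ^ 2 * p x
      = (‖s x‖ ^ 2 * p x - 2 * fderiv ℝ p x (s x))
        + ‖gradient (fun y => Real.log (p y)) x‖ ^ 2 * p x := by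
    intro x
    rw [← key x, norm_sub_sq_real]
    ring
  have e' : ∀ x, (2 * divergence s x + ‖s x‖ ^ 2) * p x
      = 2 * (divergence s x * p x) + ‖s x‖ ^ 2 * p x := fun x => by ring
  simp_rw [e, e']
  have j5 : Integrable (fun x => ‖s x‖ ^ 2 * p x - 2 * fderiv ℝ p x (s x)) :=
    j4.sub (j1.const_mul 2)
  rw [integral_add j5 hfin, integral_sub j4 (j1.const_mul 2),
    integral_add (j2.const_mul 2) j4, integral_const_mul, integral_const_mul, j3]
  ring
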